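/- Monotone decreasing convergence of the fixed-point SDA iteration: Assume the sign conditions hold, the kernel condition holds, (A, B) is stabilizable, and (Q − L R⁻¹ Lᵀ, A) is detectable. Suppose X_* ∈ ℝ^{n×n} is symmetric positive semidefinite with 𝓡(X_*) = 0 and is the unique symmetric positive semidefinite solution of 𝓡(X) = 0. Let X_0 be symmetric with X_0 ⪰ X_*, A_c(X_0) − G_c(X_0) X_0 stable, and 𝓡(X_0) ⪯ 0, and let (X_k)_{k≥0} be symmetric n×n matrices such that for every k ≥ 0: A_c(X_k)ᵀ X_{k+1} + X_{k+1} A_c(X_k) − X_{k+1} G_c(X_k) X_{k+1} + H_c(X_k) = 0 and A_c(X_k) − G_c(X_k) X_{k+1} is stable. Then: (i) X_k ⪰ X_{k+1} ⪰ X_* and 𝓡(X_k) ⪯ 0 for every k ≥ 0; (ii) X_k converges to X_* as k → ∞. -/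

import Mathlib

open Matrix Filter

noncomputable section

/-- `Π₁₁(X) = Σᵢ (A₀ⁱ)ᵀ X A₀ⁱ`. -/
def Pi11 {n r : ℕ} (A0 : Fin r → Matrix (Fin n) (Fin n) ℝ)
    (X : Matrix (Fin n) (Fin n) ℝ) : Matrix (Fin n) (Fin n) ℝ :=
  ∑ i, (A0 i)ᵀ * X * A0 i

/-- `Π₁₂(X) = Σᵢ (A₀ⁱ)ᵀ X B₀ⁱ`. -/
def Pi12 {n m r : ℕ} (A0 : Fin r → Matrix (Fin n) (Fin n) ℝ)
    (B0 : Fin r → Matrix (Fin n) (Fin m) ℝ)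
    (X : Matrix (Fin n) (Fin n) ℝ) : Matrix (Fin n) (Fin m) ℝ :=
  ∑ i, (A0 i)ᵀ * X * B0 i

/-- `Π₂₂(X) = Σᵢ (B₀ⁱ)ᵀ X B₀ⁱ`. -/
def Pi22 {n m r : ℕ} (B0 : Fin r → Matrix (Fin n) (Fin m) ℝ)
    (X : Matrix (Fin n) (Fin n) ℝ) : Matrix (Fin m) (Fin m) ℝ :=
  ∑ i, (B0 i)ᵀ * X * B0 i

/-- The block matrix `Π(X) = [Π₁₁(X), Π₁₂(X); Π₁₂(X)ᵀ, Π₂₂(X)]`. -/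
def PiBlock {n m r : ℕ} (A0 : Fin r → Matrix (Fin n) (Fin n) ℝ)
    (B0 : Fin r → Matrix (Fin n) (Fin m) ℝ)
    (X : Matrix (Fin n) (Fin n) ℝ) : Matrix (Fin n ⊕ Fin m) (Fin n ⊕ Fin m) ℝ :=
  fromBlocks (Pi11 A0 X) (Pi12 A0 B0 X) (Pi12 A0 B0 X)ᵀ (Pi22 B0 X)

/-- `L_c(X) = L + Π₁₂(X)`. -/
def Lc {n m r : ℕ} (L : Matrix (Fin n) (Fin m) ℝ)
    (A0 : Fin r → Matrix (Fin n) (Fin n) ℝ) (B0 : Fin r → Matrix (Fin n) (Fin m) ℝ)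
    (X : Matrix (Fin n) (Fin n) ℝ) : Matrix (Fin n) (Fin m) ℝ :=
  L + Pi12 A0 B0 X

/-- `R_c(X) = R + Π₂₂(X)`. -/
def Rc {n m r : ℕ} (R : Matrix (Fin m) (Fin m) ℝ)
    (B0 : Fin r → Matrix (Fin n) (Fin m) ℝ)
    (X : Matrix (Fin n) (Fin n) ℝ) : Matrix (Fin m) (Fin m) ℝ :=
  R + Pi22 B0 X

/-- `Q_c(X) = Q + Π₁₁(X)`. -/
def Qc {n r : ℕ} (Q : Matrix (Fin n) (Fin n) ℝ)
    (A0 : Fin r → Matrix (Fin n) (Fin n) ℝ)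
    (X : Matrix (Fin n) (Fin n) ℝ) : Matrix (Fin n) (Fin n) ℝ :=
  Q + Pi11 A0 X

/-- `A_c(X) = A − B R_c(X)⁻¹ L_c(X)ᵀ`. -/
def Ac {n m r : ℕ} (A : Matrix (Fin n) (Fin n) ℝ) (B : Matrix (Fin n) (Fin m) ℝ)
    (L : Matrix (Fin n) (Fin m) ℝ) (R : Matrix (Fin m) (Fin m) ℝ)
    (A0 : Fin r → Matrix (Fin n) (Fin n) ℝ) (B0 : Fin r → Matrix (Fin n) (Fin m) ℝ)
    (X : Matrix (Fin n) (Fin n) ℝ) : Matrix (Fin n) (Fin n) ℝ :=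
  A - B * (Rc R B0 X)⁻¹ * (Lc L A0 B0 X)ᵀ

/-- `G_c(X) = B R_c(X)⁻¹ Bᵀ`. -/
def Gc {n m r : ℕ} (B : Matrix (Fin n) (Fin m) ℝ) (R : Matrix (Fin m) (Fin m) ℝ)
    (B0 : Fin r → Matrix (Fin n) (Fin m) ℝ)
    (X : Matrix (Fin n) (Fin n) ℝ) : Matrix (Fin n) (Fin n) ℝ :=
  B * (Rc R B0 X)⁻¹ * Bᵀ

/-- `H_c(X) = Q_c(X) − L_c(X) R_c(X)⁻¹ L_c(X)ᵀ`. -/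
def Hc {n m r : ℕ} (Q : Matrix (Fin n) (Fin n) ℝ) (L : Matrix (Fin n) (Fin m) ℝ)
    (R : Matrix (Fin m) (Fin m) ℝ)
    (A0 : Fin r → Matrix (Fin n) (Fin n) ℝ) (B0 : Fin r → Matrix (Fin n) (Fin m) ℝ)
    (X : Matrix (Fin n) (Fin n) ℝ) : Matrix (Fin n) (Fin n) ℝ :=
  Qc Q A0 X - Lc L A0 B0 X * (Rc R B0 X)⁻¹ * (Lc L A0 B0 X)ᵀ

/-- The SCARE residual
`𝓡(X) = AᵀX + XA + Q_c(X) − (XB + L_c(X)) R_c(X)⁻¹ (XB + L_c(X))ᵀ`. -/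
def scareRes {n m r : ℕ} (A : Matrix (Fin n) (Fin n) ℝ) (B : Matrix (Fin n) (Fin m) ℝ)
    (Q : Matrix (Fin n) (Fin n) ℝ) (L : Matrix (Fin n) (Fin m) ℝ)
    (R : Matrix (Fin m) (Fin m) ℝ)
    (A0 : Fin r → Matrix (Fin n) (Fin n) ℝ) (B0 : Fin r → Matrix (Fin n) (Fin m) ℝ)
    (X : Matrix (Fin n) (Fin n) ℝ) : Matrix (Fin n) (Fin n) ℝ :=
  Aᵀ * X + X * A + Qc Q A0 X -
    (X * B + Lc L A0 B0 X) * (Rc R B0 X)⁻¹ * (X * B + Lc L A0 B0 X)ᵀ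

/-- `Ω(X) = [−G_c(X), −A_c(X); −A_c(X)ᵀ, H_c(X)]`. -/
def Omega {n m r : ℕ} (A : Matrix (Fin n) (Fin n) ℝ) (B : Matrix (Fin n) (Fin m) ℝ)
    (Q : Matrix (Fin n) (Fin n) ℝ) (L : Matrix (Fin n) (Fin m) ℝ)
    (R : Matrix (Fin m) (Fin m) ℝ)
    (A0 : Fin r → Matrix (Fin n) (Fin n) ℝ) (B0 : Fin r → Matrix (Fin n) (Fin m) ℝ)
    (X : Matrix (Fin n) (Fin n) ℝ) : Matrix (Fin n ⊕ Fin n) (Fin n ⊕ Fin n) ℝ :=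
  fromBlocks (-(Gc B R B0 X)) (-(Ac A B L R A0 B0 X)) (-(Ac A B L R A0 B0 X))ᵀ
    (Hc Q L R A0 B0 X)

/-- The `2n×n` matrix `[X; −Iₙ]` stacking `X` over `−Iₙ`. -/
def stackNegI {n : ℕ} (X : Matrix (Fin n) (Fin n) ℝ) :
    Matrix (Fin n ⊕ Fin n) (Fin n) ℝ :=
  fromRows X (-1)

/-- The pair `(A, B)` is stabilizable: `yᴴ(A − λI) = 0`, `yᴴB = 0`, `Re λ ≥ 0` imply `y = 0`. -/
def Stabilizable {n m : ℕ} (A : Matrix (Fin n) (Fin n) ℝ)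
    (B : Matrix (Fin n) (Fin m) ℝ) : Prop :=
  ∀ (lam : ℂ) (y : Fin n → ℂ), 0 ≤ lam.re →
    vecMul (star y) (A.map Complex.ofReal - lam • 1) = 0 →
    vecMul (star y) (B.map Complex.ofReal) = 0 → y = 0

/-- The pair `(C, A)` is detectable: `(A − λI)z = 0`, `Cz = 0`, `Re λ ≥ 0` imply `z = 0`. -/
def Detectable {p n : ℕ} (C : Matrix (Fin p) (Fin n) ℝ)
    (A : Matrix (Fin n) (Fin n) ℝ) : Prop :=
  ∀ (lam : ℂ) (z : Fin n → ℂ), 0 ≤ lam.re →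
    mulVec (A.map Complex.ofReal - lam • 1) z = 0 →
    mulVec (C.map Complex.ofReal) z = 0 → z = 0

/-- A real square matrix is stable if all its (complex) eigenvalues have negative real part. -/
def IsStableMatrix {n : ℕ} (M : Matrix (Fin n) (Fin n) ℝ) : Prop :=
  ∀ μ ∈ spectrum ℂ (M.map Complex.ofReal), μ.re < 0

/-- Kernel condition: `(Q − LR⁻¹Lᵀ)z = 0` implies `Lᵀz = 0` and `A₀ⁱ z = 0` for all `i`. -/
def KernelCondition {n m r : ℕ} (Q : Matrix (Fin n) (Fin n) ℝ)
    (L : Matrix (Fin n) (Fin m) ℝ) (R : Matrix (Fin m) (Fin m) ℝ)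
    (A0 : Fin r → Matrix (Fin n) (Fin n) ℝ) : Prop :=
  ∀ z : Fin n → ℂ,
    mulVec ((Q - L * R⁻¹ * Lᵀ).map Complex.ofReal) z = 0 →
    mulVec (Lᵀ.map Complex.ofReal) z = 0 ∧
      ∀ i, mulVec ((A0 i).map Complex.ofReal) z = 0

/-- `Γ(X) = [[0, −A, −B], [−Aᵀ, Q_c(X), L_c(X)], [−Bᵀ, L_c(X)ᵀ, R_c(X)]]`. -/
def Gamma {n m r : ℕ} (A : Matrix (Fin n) (Fin n) ℝ) (B : Matrix (Fin n) (Fin m) ℝ)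
    (Q : Matrix (Fin n) (Fin n) ℝ) (L : Matrix (Fin n) (Fin m) ℝ)
    (R : Matrix (Fin m) (Fin m) ℝ)
    (A0 : Fin r → Matrix (Fin n) (Fin n) ℝ) (B0 : Fin r → Matrix (Fin n) (Fin m) ℝ)
    (X : Matrix (Fin n) (Fin n) ℝ) :
    Matrix ((Fin n ⊕ Fin n) ⊕ Fin m) ((Fin n ⊕ Fin n) ⊕ Fin m) ℝ :=
  fromBlocks (fromBlocks 0 (-A) (-Aᵀ) (Qc Q A0 X))
    (fromRows (-B) (Lc L A0 B0 X))
    (fromRows (-B) (Lc L A0 B0 X))ᵀ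
    (Rc R B0 X)

/-- `F_W(Y) = [Y; −Iₙ]ᵀ (Ω(Y) − Ω(W)) [Y; −Iₙ]`. -/
def FW {n m r : ℕ} (A : Matrix (Fin n) (Fin n) ℝ) (B : Matrix (Fin n) (Fin m) ℝ)
    (Q : Matrix (Fin n) (Fin n) ℝ) (L : Matrix (Fin n) (Fin m) ℝ)
    (R : Matrix (Fin m) (Fin m) ℝ)
    (A0 : Fin r → Matrix (Fin n) (Fin n) ℝ) (B0 : Fin r → Matrix (Fin n) (Fin m) ℝ)
    (W Y : Matrix (Fin n) (Fin n) ℝ) : Matrix (Fin n) (Fin n) ℝ :=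
  (stackNegI Y)ᵀ * (Omega A B Q L R A0 B0 Y - Omega A B Q L R A0 B0 W) * stackNegI Y

/-- `𝓕_W(Z) = Kᵀ Π(Z) K` with `K = [−Iₙ; R_c(W)⁻¹ (L_c(W) + W B)ᵀ]`. -/
def Fcal {n m r : ℕ} (B : Matrix (Fin n) (Fin m) ℝ)
    (L : Matrix (Fin n) (Fin m) ℝ) (R : Matrix (Fin m) (Fin m) ℝ)
    (A0 : Fin r → Matrix (Fin n) (Fin n) ℝ) (B0 : Fin r → Matrix (Fin n) (Fin m) ℝ)
    (W Z : Matrix (Fin n) (Fin n) ℝ) : Matrix (Fin n) (Fin n) ℝ :=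
  (fromRows (-1 : Matrix (Fin n) (Fin n) ℝ)
      ((Rc R B0 W)⁻¹ * (Lc L A0 B0 W + W * B)ᵀ))ᵀ *
    PiBlock A0 B0 Z *
    fromRows (-1 : Matrix (Fin n) (Fin n) ℝ)
      ((Rc R B0 W)⁻¹ * (Lc L A0 B0 W + W * B)ᵀ)

/-! ### Auxiliary facts -/

lemma aux_pow_tendsto {E : Type*} [NormedRing E] [NormedAlgebra ℂ E] [CompleteSpace E] (a : E)
    (h : spectralRadius ℂ a < 1) : Tendsto (fun k : ℕ => a ^ k) atTop (nhds 0) := by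
  obtain ⟨s, hs1, hs2⟩ := exists_between h
  have hg := spectrum.pow_nnnorm_pow_one_div_tendsto_nhds_spectralRadius a
  have hev := hg.eventually (gt_mem_nhds hs1)
  lift s to NNReal using (hs2.trans ENNReal.one_lt_top).ne
  have hs2' : s < 1 := by exact_mod_cast hs2
  apply squeeze_zero_norm' (a := fun k : ℕ => (s : ℝ) ^ k)
  · filter_upwards [hev, eventually_ge_atTop 1] with k hk hk1
    have hk0 : (k : ℝ) ≠ 0 := by positivity
    have h2 := ENNReal.rpow_le_rpow hk.le (z := (k : ℝ)) (by positivity)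
    rw [← ENNReal.rpow_mul, one_div, inv_mul_cancel₀ hk0, ENNReal.rpow_one,
      ENNReal.rpow_natCast] at h2
    have h3 : ‖a ^ k‖₊ ≤ s ^ k := by exact_mod_cast h2
    exact_mod_cast h3
  · exact tendsto_pow_atTop_nhds_zero_of_lt_one s.2 (by exact_mod_cast hs2')

lemma aux_mem_spectrum {n : ℕ} (M : Matrix (Fin n) (Fin n) ℂ) (μ : ℂ) :
    μ ∈ spectrum ℂ M ↔ ∃ v : Fin n → ℂ, v ≠ 0 ∧ M *ᵥ v = μ • v := by
  rw [spectrum.mem_iff, Matrix.isUnit_iff_isUnit_det, isUnit_iff_ne_zero, not_not,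
    ← Matrix.exists_mulVec_eq_zero_iff]
  refine exists_congr fun v => and_congr_right fun _ => ?_
  rw [Matrix.sub_mulVec, sub_eq_zero, Algebra.algebraMap_eq_smul_one, Matrix.smul_mulVec,
    Matrix.one_mulVec, eq_comm]

section
attribute [local instance] Matrix.linftyOpNormedRing Matrix.linftyOpNormedAlgebra
  Matrix.linftyOpNormedAddCommGroup Matrix.linftyOpNormedSpace

lemma aux_matrix_pow_tendsto {n : ℕ} (hn : 0 < n) (C : Matrix (Fin n) (Fin n) ℂ)
    (h : ∀ μ ∈ spectrum ℂ C, ‖μ‖ < 1) : Tendsto (fun k : ℕ => C ^ k) atTop (nhds 0) := by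
  have : Nonempty (Fin n) := ⟨⟨0, hn⟩⟩
  have : CompleteSpace (Matrix (Fin n) (Fin n) ℂ) := FiniteDimensional.complete ℂ _
  have := spectrum.spectralRadius_lt_of_forall_lt C (r := 1) (fun μ hμ => by
    exact_mod_cast h μ hμ)
  exact aux_pow_tendsto C (by exact_mod_cast this)

end

lemma aux_map_mul {a b c : ℕ} (M : Matrix (Fin a) (Fin b) ℝ) (N : Matrix (Fin b) (Fin c) ℝ) :
    (M * N).map Complex.ofReal = M.map Complex.ofReal * N.map Complex.ofReal :=
  Matrix.map_mul (f := Complex.ofRealHom)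

lemma aux_map_one {a : ℕ} :
    (1 : Matrix (Fin a) (Fin a) ℝ).map Complex.ofReal = 1 :=
  Matrix.map_one _ Complex.ofReal_zero Complex.ofReal_one

lemma aux_map_add {a b : ℕ} (M N : Matrix (Fin a) (Fin b) ℝ) :
    (M + N).map Complex.ofReal = M.map Complex.ofReal + N.map Complex.ofReal :=
  Matrix.map_add _ Complex.ofReal_add M N

lemma aux_map_sub {a b : ℕ} (M N : Matrix (Fin a) (Fin b) ℝ) :
    (M - N).map Complex.ofReal = M.map Complex.ofReal - N.map Complex.ofReal :=
  Matrix.map_sub _ Complex.ofReal_sub M N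

lemma aux_map_pow {a : ℕ} (M : Matrix (Fin a) (Fin a) ℝ) (k : ℕ) :
    (M ^ k).map Complex.ofReal = M.map Complex.ofReal ^ k :=
  Matrix.map_pow (f := Complex.ofRealHom) M k

lemma aux_psd_congr {a b : ℕ} {P : Matrix (Fin a) (Fin a) ℝ} (hP : P.PosSemidef)
    (N : Matrix (Fin a) (Fin b) ℝ) : (Nᵀ * P * N).PosSemidef := by
  have := hP.conjTranspose_mul_mul_same N
  rwa [conjTranspose_eq_transpose_of_trivial] at this

open scoped ComplexOrder in
lemma aux_psd_map {a : ℕ} {P : Matrix (Fin a) (Fin a) ℝ} (hP : P.PosSemidef) :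
    (P.map Complex.ofReal).PosSemidef := by
  obtain ⟨N, rfl⟩ : ∃ N : Matrix (Fin a) (Fin a) ℝ, P = Nᴴ * N := by
    open scoped MatrixOrder in
    exact CStarAlgebra.nonneg_iff_eq_star_mul_self.mp hP.nonneg
  rw [aux_map_mul]
  have : (Nᴴ).map Complex.ofReal = (N.map Complex.ofReal)ᴴ := by
    ext i j; simp
  rw [this]
  exact posSemidef_conjTranspose_mul_self _

/-- Cayley transform of a stable matrix has powers tending to zero. -/
lemma aux_cayley {n : ℕ} (hn : 0 < n) (M : Matrix (Fin n) (Fin n) ℝ) (hM : IsStableMatrix M) :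
    IsUnit (1 - M).det ∧
      Tendsto (fun k : ℕ => ((1 + M) * (1 - M)⁻¹) ^ k) atTop (nhds 0) := by
  have hdet : IsUnit (1 - M).det := by
    rw [isUnit_iff_ne_zero]
    intro h0
    obtain ⟨v, hv, hMv⟩ := Matrix.exists_mulVec_eq_zero_iff.mpr h0
    have : (1 : ℂ) ∈ spectrum ℂ (M.map Complex.ofReal) := by
      rw [aux_mem_spectrum]
      refine ⟨fun i => (v i : ℂ), fun h => hv ?_, ?_⟩
      · funext i; simpa using congrFun h i
      · rw [sub_mulVec, one_mulVec, sub_eq_zero] at hMv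
        funext i
        have := congrFun hMv i
        simp only [mulVec, dotProduct] at this
        simp only [mulVec, dotProduct, map_apply, one_smul]
        rw [this]; push_cast; rfl
    have := hM 1 this
    norm_num at this
  refine ⟨hdet, ?_⟩
  have hinv : (1 - M) * (1 - M)⁻¹ = 1 := Matrix.mul_nonsing_inv _ hdet
  set W := (1 - M)⁻¹ with hW
  have hinvC : (1 - M.map Complex.ofReal) * W.map Complex.ofReal = 1 := by
    rw [← aux_map_one, ← aux_map_sub, ← aux_map_mul, hinv]
  have key : Tendsto (fun k : ℕ => (((1 + M) * W).map Complex.ofReal) ^ k) atTop (nhds 0) := by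
    apply aux_matrix_pow_tendsto hn
    intro μ hμ
    rw [aux_mem_spectrum] at hμ
    obtain ⟨v, hv, hvμ⟩ := hμ
    set w := W.map Complex.ofReal *ᵥ v with hw
    set MC := M.map Complex.ofReal with hMC
    have hvw : v = w - MC *ᵥ w := by
      have : (1 - MC) *ᵥ w = v := by rw [hw, mulVec_mulVec, hinvC, one_mulVec]
      rw [← this, sub_mulVec, one_mulVec]
    have hw0 : w ≠ 0 := by
      intro h; apply hv; rw [hvw, h]; simp
    rw [aux_map_mul, ← mulVec_mulVec, ← hw, aux_map_add, aux_map_one, add_mulVec, one_mulVec,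
      hvw] at hvμ
    have e1 : (μ + 1) • (MC *ᵥ w) = (μ - 1) • w := by
      funext i
      have := congrFun hvμ i
      simp only [Pi.add_apply, Pi.smul_apply, Pi.sub_apply, smul_eq_mul] at this ⊢
      linear_combination this
    have hμ1 : μ + 1 ≠ 0 := by
      intro h
      rw [h, zero_smul, eq_comm, smul_eq_zero] at e1
      rcases e1 with e1 | e1
      · have : (2 : ℂ) = 0 := by linear_combination h - e1
        norm_num at this
      · exact hw0 e1
    have hmem : (μ - 1) / (μ + 1) ∈ spectrum ℂ MC := by
      rw [aux_mem_spectrum]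
      refine ⟨w, hw0, ?_⟩
      rw [div_eq_inv_mul, mul_smul, ← e1, smul_smul, inv_mul_cancel₀ hμ1, one_smul]
    have hre := hM _ hmem
    have hpos : 0 < Complex.normSq (μ + 1) := Complex.normSq_pos.mpr hμ1
    rw [Complex.div_re, ← add_div, div_lt_iff₀ hpos] at hre
    simp at hre
    have hsq : Complex.normSq μ < 1 := by rw [Complex.normSq_apply]; nlinarith
    rw [Complex.normSq_eq_norm_sq] at hsq
    nlinarith [norm_nonneg μ]
  have hcont : Continuous fun Z : Matrix (Fin n) (Fin n) ℂ => Z.map Complex.re :=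
    continuous_id.matrix_map Complex.continuous_re
  have k2 := (hcont.tendsto 0).comp key
  have e0 : (0 : Matrix (Fin n) (Fin n) ℂ).map Complex.re = 0 := by ext i j; simp
  rw [e0] at k2
  refine k2.congr fun k => ?_
  ext i j
  simp [← aux_map_pow]

/-- Lyapunov comparison: if `M` is stable and `-(Mᵀ D + D M)` is positive semidefinite, so is `D`. -/
lemma aux_lyapunov {n : ℕ} (hn : 0 < n) (M D : Matrix (Fin n) (Fin n) ℝ) (hM : IsStableMatrix M)
    (hD : D.IsHermitian) (h : (-(Mᵀ * D + D * M)).PosSemidef) : D.PosSemidef := by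
  obtain ⟨hdet, hC⟩ := aux_cayley hn M hM
  set C := (1 + M) * (1 - M)⁻¹ with hCdef
  have hinv : (1 - M) * (1 - M)⁻¹ = 1 := Matrix.mul_nonsing_inv _ hdet
  have hstein : (D - Cᵀ * D * C).PosSemidef := by
    have h2 := aux_psd_congr (h.add h) (1 - M)⁻¹
    have e : (-(Mᵀ * D + D * M) + -(Mᵀ * D + D * M)) =
        (1 - M)ᵀ * D * (1 - M) - (1 + M)ᵀ * D * (1 + M) := by
      simp only [transpose_sub, transpose_add, transpose_one]
      noncomm_ring
    rw [e] at h2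
    convert h2 using 1
    have : D = ((1 - M) * (1 - M)⁻¹)ᵀ * D * ((1 - M) * (1 - M)⁻¹) := by
      rw [hinv]; simp
    rw [mul_sub, sub_mul]
    nth_rewrite 1 [this]
    simp only [hCdef, transpose_mul, Matrix.mul_assoc]
  have hpow : ∀ k : ℕ, (D - (C ^ k)ᵀ * D * C ^ k).PosSemidef := by
    intro k
    induction k with
    | zero => simpa using PosSemidef.zero
    | succ k ih =>
      have := ih.add (aux_psd_congr hstein (C ^ k))
      convert this using 1
      rw [pow_succ', transpose_mul]
      noncomm_ring
  refine PosSemidef.of_dotProduct_mulVec_nonneg hD fun x => ?_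
  have hlim : Tendsto (fun k : ℕ => star x ⬝ᵥ ((D - (C ^ k)ᵀ * D * C ^ k) *ᵥ x)) atTop
      (nhds (star x ⬝ᵥ ((D - (0 : Matrix (Fin n) (Fin n) ℝ)ᵀ * D * 0) *ᵥ x))) := by
    have hcont : Continuous fun Z : Matrix (Fin n) (Fin n) ℝ =>
        star x ⬝ᵥ ((D - Zᵀ * D * Z) *ᵥ x) := by fun_prop
    exact (hcont.tendsto _).comp hC
  have := ge_of_tendsto' hlim (fun k => (hpow k).dotProduct_mulVec_nonneg x)
  simpa using this

/-- Comparison for Riccati maps `f(Y) = aᵀ Y + Y a - Y G Y + H`. -/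
lemma aux_compare {n : ℕ} (hn : 0 < n) (a G H Y Z : Matrix (Fin n) (Fin n) ℝ)
    (hG : G.PosSemidef) (hY : Y.IsHermitian) (hZ : Z.IsHermitian)
    (hst : IsStableMatrix (a - G * Y))
    (h : ((aᵀ * Z + Z * a - Z * G * Z + H) - (aᵀ * Y + Y * a - Y * G * Y + H)).PosSemidef) :
    (Y - Z).PosSemidef := by
  have hYZ : (Y - Z).IsHermitian := hY.sub hZ
  refine aux_lyapunov hn (a - G * Y) (Y - Z) hst hYZ ?_
  have h2 := h.add (aux_psd_congr hG (Y - Z))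
  convert h2 using 1
  have tY : Yᵀ = Y := by simpa [IsHermitian] using hY
  have tZ : Zᵀ = Z := by simpa [IsHermitian] using hZ
  have tG : Gᵀ = G := by simpa [IsHermitian] using hG.1
  simp only [transpose_sub, transpose_mul, tY, tZ, tG]
  noncomm_ring

/-- The partially frozen residual. -/
def auxRes {n m r : ℕ} (A : Matrix (Fin n) (Fin n) ℝ) (B : Matrix (Fin n) (Fin m) ℝ)
    (Q : Matrix (Fin n) (Fin n) ℝ) (L : Matrix (Fin n) (Fin m) ℝ)
    (R : Matrix (Fin m) (Fin m) ℝ)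
    (A0 : Fin r → Matrix (Fin n) (Fin n) ℝ) (B0 : Fin r → Matrix (Fin n) (Fin m) ℝ)
    (W Y : Matrix (Fin n) (Fin n) ℝ) : Matrix (Fin n) (Fin n) ℝ :=
  Aᵀ * Y + Y * A + Qc Q A0 W -
    (Y * B + Lc L A0 B0 W) * (Rc R B0 W)⁻¹ * (Y * B + Lc L A0 B0 W)ᵀ

/-- Completion of squares. -/
lemma aux_square {n m : ℕ} (P : Matrix (Fin n) (Fin n) ℝ) (N : Matrix (Fin n) (Fin m) ℝ)
    (K : Matrix (Fin m) (Fin m) ℝ) (F : Matrix (Fin m) (Fin n) ℝ) (hK : K.PosDef) :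
    P - N * K⁻¹ * Nᵀ + (F + K⁻¹ * Nᵀ)ᵀ * K * (F + K⁻¹ * Nᵀ) =
      P + N * F + Fᵀ * Nᵀ + Fᵀ * K * F := by
  have hu : IsUnit K.det := (Matrix.isUnit_iff_isUnit_det K).mp hK.isUnit
  have tK : (K⁻¹)ᵀ = K⁻¹ := by simpa [IsHermitian] using hK.inv.1
  have h1 : ∀ V : Matrix (Fin m) (Fin n) ℝ, K⁻¹ * (K * V) = V := fun V => by
    rw [← Matrix.mul_assoc, Matrix.nonsing_inv_mul _ hu, Matrix.one_mul]
  have h2 : ∀ V : Matrix (Fin m) (Fin n) ℝ, K * (K⁻¹ * V) = V := fun V => by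
    rw [← Matrix.mul_assoc, Matrix.mul_nonsing_inv _ hu, Matrix.one_mul]
  simp only [transpose_add, transpose_mul, transpose_transpose, tK, Matrix.add_mul,
    Matrix.mul_add, Matrix.mul_assoc, h1, h2]
  abel

section
variable {n m r : ℕ} {A Q : Matrix (Fin n) (Fin n) ℝ} {B L : Matrix (Fin n) (Fin m) ℝ}
    {R : Matrix (Fin m) (Fin m) ℝ}
    {A0 : Fin r → Matrix (Fin n) (Fin n) ℝ} {B0 : Fin r → Matrix (Fin n) (Fin m) ℝ}

lemma aux_Rc (hR : R.PosDef) {W : Matrix (Fin n) (Fin n) ℝ} (hW : W.PosSemidef) :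
    (Rc R B0 W).PosDef :=
  hR.add_posSemidef (posSemidef_sum _ fun i _ => aux_psd_congr hW (B0 i))

lemma aux_Gc (hR : R.PosDef) {W : Matrix (Fin n) (Fin n) ℝ} (hW : W.PosSemidef) :
    (Gc B R B0 W).PosSemidef := by
  have := aux_psd_congr (aux_Rc (B0 := B0) hR hW).inv.posSemidef Bᵀ
  rwa [transpose_transpose] at this

lemma aux_iter_eq (hR : R.PosDef) {W Y : Matrix (Fin n) (Fin n) ℝ} (hW : W.PosSemidef)
    (hY : Y.IsHermitian) :
    (Ac A B L R A0 B0 W)ᵀ * Y + Y * Ac A B L R A0 B0 W - Y * Gc B R B0 W * Y +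
      Hc Q L R A0 B0 W = auxRes A B Q L R A0 B0 W Y := by
  have tY : Yᵀ = Y := by simpa [IsHermitian] using hY
  have tK : ((Rc R B0 W)⁻¹)ᵀ = (Rc R B0 W)⁻¹ := by
    simpa [IsHermitian] using (aux_Rc (B0 := B0) hR hW).inv.1
  simp only [Ac, Gc, Hc, auxRes, transpose_sub, transpose_add, transpose_mul,
    transpose_transpose, tK, tY, Matrix.add_mul, Matrix.mul_add, Matrix.sub_mul, Matrix.mul_sub,
    Matrix.mul_assoc]
  abel

/-- Closed-loop form of the completed square. -/
lemma aux_closed (F : Matrix (Fin m) (Fin n) ℝ) {W Y : Matrix (Fin n) (Fin n) ℝ}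
    (hW : W.IsHermitian) (hY : Y.IsHermitian) :
    (Aᵀ * Y + Y * A + Qc Q A0 W) + (Y * B + Lc L A0 B0 W) * F +
      Fᵀ * (Y * B + Lc L A0 B0 W)ᵀ + Fᵀ * Rc R B0 W * F =
    ((A + B * F)ᵀ * Y + Y * (A + B * F)) + (Q + L * F + Fᵀ * Lᵀ + Fᵀ * R * F) +
      ∑ i, (A0 i + B0 i * F)ᵀ * W * (A0 i + B0 i * F) := by
  have tY : Yᵀ = Y := by simpa [IsHermitian] using hY
  have tW : Wᵀ = W := by simpa [IsHermitian] using hW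
  simp only [Qc, Lc, Rc, Pi11, Pi12, Pi22, transpose_add, transpose_mul, transpose_transpose,
    transpose_sum, tY, tW, Matrix.add_mul, Matrix.mul_add, Matrix.sum_mul, Matrix.mul_sum,
    Finset.sum_add_distrib, Matrix.mul_assoc]
  abel

lemma aux_res_mono (hR : R.PosDef) {W V Y : Matrix (Fin n) (Fin n) ℝ} (hV : V.PosSemidef)
    (hWV : (W - V).PosSemidef) (hY : Y.IsHermitian) :
    (auxRes A B Q L R A0 B0 W Y - auxRes A B Q L R A0 B0 V Y).PosSemidef := by
  have hW : W.PosSemidef := by simpa using hWV.add hV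
  set F : Matrix (Fin m) (Fin n) ℝ := -((Rc R B0 W)⁻¹ * (Y * B + Lc L A0 B0 W)ᵀ) with hF
  have s1 := aux_square (Aᵀ * Y + Y * A + Qc Q A0 W) (Y * B + Lc L A0 B0 W) (Rc R B0 W) F
    (aux_Rc hR hW)
  have s2 := aux_square (Aᵀ * Y + Y * A + Qc Q A0 V) (Y * B + Lc L A0 B0 V) (Rc R B0 V) F
    (aux_Rc hR hV)
  rw [aux_closed F hW.1 hY] at s1
  rw [aux_closed F hV.1 hY] at s2
  have hz : F + (Rc R B0 W)⁻¹ * (Y * B + Lc L A0 B0 W)ᵀ = 0 := by rw [hF]; simp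
  rw [hz, Matrix.mul_zero, add_zero] at s1
  have p1 : (∑ i, (A0 i + B0 i * F)ᵀ * (W - V) * (A0 i + B0 i * F)).PosSemidef :=
    posSemidef_sum _ fun i _ => aux_psd_congr hWV _
  have p2 := aux_psd_congr (aux_Rc (B0 := B0) hR hV).posSemidef
    (F + (Rc R B0 V)⁻¹ * (Y * B + Lc L A0 B0 V)ᵀ)
  convert p1.add p2 using 1
  rw [auxRes, auxRes, s1, eq_sub_of_add_eq s2]
  simp only [Matrix.mul_sub, Matrix.sub_mul, Finset.sum_sub_distrib]
  abel

open scoped ComplexOrder in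
/-- Eigenvectors for closed-right-half-plane eigenvalues are annihilated by the source term. -/
lemma aux_unobs {M Y K : Matrix (Fin n) (Fin n) ℝ} (hY : Y.PosSemidef) (hK : K.PosSemidef)
    (h : (-((Mᵀ * Y + Y * M) + K)).PosSemidef) (lam : ℂ) (hlam : 0 ≤ lam.re) (z : Fin n → ℂ)
    (hz : M.map Complex.ofReal *ᵥ z = lam • z) : K.map Complex.ofReal *ᵥ z = 0 := by
  have hYC := aux_psd_map hY
  have hKC := aux_psd_map hK
  have hC := (aux_psd_map h).dotProduct_mulVec_nonneg z
  have hy := hYC.dotProduct_mulVec_nonneg z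
  have hk := hKC.dotProduct_mulVec_nonneg z
  rw [← hKC.dotProduct_mulVec_zero_iff]
  have e : (-((Mᵀ * Y + Y * M) + K)).map Complex.ofReal =
      -(((M.map Complex.ofReal)ᴴ * Y.map Complex.ofReal +
        Y.map Complex.ofReal * M.map Complex.ofReal) + K.map Complex.ofReal) := by
    have t : (M.map Complex.ofReal)ᴴ = (Mᵀ).map Complex.ofReal := by ext i j; simp
    rw [t, ← aux_map_mul, ← aux_map_mul, ← aux_map_add, ← aux_map_add]
    ext i j; simp
  rw [e, neg_mulVec, dotProduct_neg, add_mulVec, add_mulVec, dotProduct_add, dotProduct_add,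
    ← mulVec_mulVec, ← mulVec_mulVec, hz, mulVec_smul, dotProduct_smul,
    dotProduct_mulVec (star z) (M.map Complex.ofReal)ᴴ, ← star_mulVec, hz, star_smul,
    smul_dotProduct] at hC
  rw [Complex.le_def] at hC hy hk
  simp only [Complex.zero_re, Complex.zero_im, smul_eq_mul, Complex.neg_re, Complex.add_re,
    Complex.mul_re, Complex.star_def, Complex.conj_re, Complex.conj_im] at hC hy hk
  apply Complex.ext
  · simp only [Complex.zero_re]
    nlinarith [hC.1, hy.1, hk.1, mul_nonneg hlam hy.1, hy.2, hk.2]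
  · simpa using hk.2.symm

open scoped ComplexOrder in
lemma aux_stab (hR : R.PosDef) (hsign : (fromBlocks Q L Lᵀ R).PosSemidef)
    (hker : KernelCondition Q L R A0) (hdet : Detectable (Q - L * R⁻¹ * Lᵀ) A)
    {Y : Matrix (Fin n) (Fin n) ℝ} (hY : Y.PosSemidef)
    (hres : (-(scareRes A B Q L R A0 B0 Y)).PosSemidef) :
    IsStableMatrix (Ac A B L R A0 B0 Y - Gc B R B0 Y * Y) := by
  have tY : Yᵀ = Y := by simpa [IsHermitian] using hY.1
  set F : Matrix (Fin m) (Fin n) ℝ := -((Rc R B0 Y)⁻¹ * (Y * B + Lc L A0 B0 Y)ᵀ) with hF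
  have hM : Ac A B L R A0 B0 Y - Gc B R B0 Y * Y = A + B * F := by
    simp only [hF, Ac, Gc, transpose_add, transpose_mul, tY, Matrix.mul_neg, Matrix.mul_add,
      Matrix.mul_assoc]
    abel
  have s1 := aux_square (Aᵀ * Y + Y * A + Qc Q A0 Y) (Y * B + Lc L A0 B0 Y) (Rc R B0 Y) F
    (aux_Rc hR hY)
  have hz0 : F + (Rc R B0 Y)⁻¹ * (Y * B + Lc L A0 B0 Y)ᵀ = 0 := by rw [hF]; simp
  rw [aux_closed F hY.1 hY.1, hz0, Matrix.mul_zero, add_zero,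
    ← aux_square Q L R F hR] at s1
  have hH : (Q - L * R⁻¹ * Lᵀ).PosSemidef := by
    have hinv := hR.isUnit.invertible
    have := (PosDef.fromBlocks₂₂ Q L hR).mp (by
      rwa [conjTranspose_eq_transpose_of_trivial])
    rwa [conjTranspose_eq_transpose_of_trivial] at this
  set H := Q - L * R⁻¹ * Lᵀ with hHdef
  set U := F + R⁻¹ * Lᵀ with hU
  have hUR := aux_psd_congr hR.posSemidef U
  have hS : (∑ i, (A0 i + B0 i * F)ᵀ * Y * (A0 i + B0 i * F)).PosSemidef :=
    posSemidef_sum _ fun i _ => aux_psd_congr hY _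
  rw [scareRes, s1] at hres
  rw [hM]
  intro lam hmem
  by_contra hneg
  push Not at hneg
  obtain ⟨z, hz, hMz⟩ := (aux_mem_spectrum _ _).mp hmem
  have hHz : H.map Complex.ofReal *ᵥ z = 0 := by
    refine aux_unobs (M := A + B * F) hY hH ?_ lam hneg z hMz
    convert (hres.add hUR).add hS using 1
    abel
  have hURz : (Uᵀ * R * U).map Complex.ofReal *ᵥ z = 0 := by
    refine aux_unobs (M := A + B * F) hY hUR ?_ lam hneg z hMz
    convert (hres.add hH).add hS using 1
    abel
  have hUz : U.map Complex.ofReal *ᵥ z = 0 := by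
    have t : (Uᵀ).map Complex.ofReal = (U.map Complex.ofReal)ᴴ := by ext i j; simp
    have h1 : R.map Complex.ofReal *ᵥ (U.map Complex.ofReal *ᵥ z) = 0 := by
      rw [← (aux_psd_map hR.posSemidef).dotProduct_mulVec_zero_iff, star_mulVec,
        ← dotProduct_mulVec, mulVec_mulVec, mulVec_mulVec, ← t,
        ← aux_map_mul, ← aux_map_mul, hURz, dotProduct_zero]
    have h2 : (R⁻¹).map Complex.ofReal * R.map Complex.ofReal = 1 := by
      rw [← aux_map_mul, Matrix.nonsing_inv_mul _ ((Matrix.isUnit_iff_isUnit_det R).mp hR.isUnit),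
        aux_map_one]
    have h3 := congrArg (fun v => (R⁻¹).map Complex.ofReal *ᵥ v) h1
    simpa only [mulVec_mulVec, ← Matrix.mul_assoc, h2, Matrix.one_mul, mulVec_zero] using h3
  have hLz := (hker z hHz).1
  have hFz : F.map Complex.ofReal *ᵥ z = 0 := by
    rw [hU, aux_map_add, add_mulVec, aux_map_mul, ← mulVec_mulVec, hLz, mulVec_zero,
      add_zero] at hUz
    exact hUz
  refine hz (hdet lam z hneg ?_ hHz)
  rw [aux_map_add, add_mulVec, aux_map_mul, ← mulVec_mulVec, hFz, mulVec_zero, add_zero] at hMz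
  rw [sub_mulVec, hMz, smul_mulVec, one_mulVec, sub_self]

end

/-- A decreasing sequence of symmetric matrices bounded below converges. -/
lemma aux_monotone_conv {n : ℕ} (X : ℕ → Matrix (Fin n) (Fin n) ℝ) (Xs : Matrix (Fin n) (Fin n) ℝ)
    (hsymm : ∀ k, (X k).IsHermitian) (hdec : ∀ k, (X k - X (k + 1)).PosSemidef)
    (hge : ∀ k, (X k - Xs).PosSemidef) : ∃ Y, Tendsto X atTop (nhds Y) := by
  have hq : ∀ x : Fin n → ℝ, ∃ l : ℝ, Tendsto (fun k => x ⬝ᵥ (X k *ᵥ x)) atTop (nhds l) := by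
    intro x
    refine ⟨_, tendsto_atTop_ciInf (antitone_nat_of_succ_le fun k => ?_) ⟨x ⬝ᵥ (Xs *ᵥ x), ?_⟩⟩
    · have := (hdec k).dotProduct_mulVec_nonneg x
      rw [star_trivial, sub_mulVec, dotProduct_sub] at this
      linarith
    · rintro _ ⟨k, rfl⟩
      have := (hge k).dotProduct_mulVec_nonneg x
      rw [star_trivial, sub_mulVec, dotProduct_sub] at this
      simp only
      linarith
  choose l hl using hq
  refine ⟨Matrix.of fun i j => (l (Pi.single i 1 + Pi.single j 1) - l (Pi.single i 1) -
    l (Pi.single j 1)) / 2, ?_⟩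
  refine tendsto_pi_nhds.mpr fun i => tendsto_pi_nhds.mpr fun j => ?_
  have := (((hl (Pi.single i 1 + Pi.single j 1)).sub (hl (Pi.single i 1))).sub
    (hl (Pi.single j 1))).div_const 2
  refine this.congr fun k => ?_
  have hs : X k j i = X k i j := by simpa using (hsymm k).apply i j
  simp [mulVec_add, add_dotProduct, dotProduct_add, hs]
  ring

lemma aux_psd_closed {n : ℕ} (X : ℕ → Matrix (Fin n) (Fin n) ℝ) (Y : Matrix (Fin n) (Fin n) ℝ)
    (hX : ∀ k, (X k).PosSemidef) (hY : Tendsto X atTop (nhds Y)) : Y.PosSemidef := by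
  refine PosSemidef.of_dotProduct_mulVec_nonneg ?_ fun x => ?_
  · have hc : Continuous fun Z : Matrix (Fin n) (Fin n) ℝ => Zᴴ := by fun_prop
    have h1 := (hc.tendsto Y).comp hY
    exact tendsto_nhds_unique (h1.congr fun k => (hX k).1) hY
  · have hc : Continuous fun Z : Matrix (Fin n) (Fin n) ℝ => star x ⬝ᵥ (Z *ᵥ x) := by fun_prop
    exact ge_of_tendsto' ((hc.tendsto Y).comp hY) fun k => (hX k).dotProduct_mulVec_nonneg x

/-- Monotone decreasing convergence of the fixed-point SDA iteration. -/
theorem stmt14 (n m r : ℕ) (hn : 0 < n) (hm : 0 < m) (hr : 0 < r)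
    (A Q : Matrix (Fin n) (Fin n) ℝ) (B L : Matrix (Fin n) (Fin m) ℝ)
    (R : Matrix (Fin m) (Fin m) ℝ)
    (A0 : Fin r → Matrix (Fin n) (Fin n) ℝ) (B0 : Fin r → Matrix (Fin n) (Fin m) ℝ)
    (hQ : Q.IsHermitian) (hRsymm : R.IsHermitian)
    (hRpd : R.PosDef) (hsign : (fromBlocks Q L Lᵀ R).PosSemidef)
    (hker : KernelCondition Q L R A0)
    (hstab : Stabilizable A B)
    (hdet : Detectable (Q - L * R⁻¹ * Lᵀ) A)
    (Xs : Matrix (Fin n) (Fin n) ℝ) (hXs : Xs.PosSemidef)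
    (hsol : scareRes A B Q L R A0 B0 Xs = 0)
    (huniq : ∀ Y : Matrix (Fin n) (Fin n) ℝ, Y.PosSemidef →
      scareRes A B Q L R A0 B0 Y = 0 → Y = Xs)
    (X : ℕ → Matrix (Fin n) (Fin n) ℝ)
    (hsymm : ∀ k, (X k).IsHermitian)
    (h0ge : (X 0 - Xs).PosSemidef)
    (h0stab : IsStableMatrix (Ac A B L R A0 B0 (X 0) - Gc B R B0 (X 0) * X 0))
    (h0res : (-(scareRes A B Q L R A0 B0 (X 0))).PosSemidef)
    (hiter : ∀ k, (Ac A B L R A0 B0 (X k))ᵀ * X (k+1) +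
        X (k+1) * Ac A B L R A0 B0 (X k) -
        X (k+1) * Gc B R B0 (X k) * X (k+1) + Hc Q L R A0 B0 (X k) = 0)
    (hstable : ∀ k, IsStableMatrix (Ac A B L R A0 B0 (X k) - Gc B R B0 (X k) * X (k+1))) :
    (∀ k, (X k - X (k+1)).PosSemidef ∧ (X (k+1) - Xs).PosSemidef ∧
        (-(scareRes A B Q L R A0 B0 (X k))).PosSemidef) ∧
      Tendsto X atTop (nhds Xs) := by
  have step : ∀ k, (X k - Xs).PosSemidef → (-(scareRes A B Q L R A0 B0 (X k))).PosSemidef →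
      (X k - X (k+1)).PosSemidef ∧ (X (k+1) - Xs).PosSemidef ∧
        (-(scareRes A B Q L R A0 B0 (X (k+1)))).PosSemidef := by
    intro k hge hres
    have hXk : (X k).PosSemidef := by simpa using hge.add hXs
    have hG : (Gc B R B0 (X k)).PosSemidef := aux_Gc hRpd hXk
    have hit := hiter k
    have d1 : (X k - X (k+1)).PosSemidef := by
      refine aux_compare hn (Ac A B L R A0 B0 (X k)) (Gc B R B0 (X k)) (Hc Q L R A0 B0 (X k))
        _ _ hG (hsymm k) (hsymm (k+1)) (aux_stab hRpd hsign hker hdet hXk hres) ?_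
      rw [hit, aux_iter_eq hRpd hXk (hsymm k), zero_sub]
      exact hres
    have d2 : (X (k+1) - Xs).PosSemidef := by
      refine aux_compare hn (Ac A B L R A0 B0 (X k)) (Gc B R B0 (X k)) (Hc Q L R A0 B0 (X k))
        _ _ hG (hsymm (k+1)) hXs.1 (hstable k) ?_
      rw [hit, aux_iter_eq hRpd hXk hXs.1]
      have := aux_res_mono (A := A) (B := B) (Q := Q) (L := L) (A0 := A0) (B0 := B0)
        hRpd hXs hge hXs.1
      have e : auxRes A B Q L R A0 B0 Xs Xs = 0 := hsol
      rwa [e] at this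
    refine ⟨d1, d2, ?_⟩
    have hXk1 : (X (k+1)).PosSemidef := by simpa using d2.add hXs
    have := aux_res_mono (A := A) (B := B) (Q := Q) (L := L) (A0 := A0) (B0 := B0)
      hRpd hXk1 d1 (hsymm (k+1))
    rw [← aux_iter_eq hRpd hXk (hsymm (k+1)), hit, zero_sub] at this
    exact this
  have all : ∀ k, (X k - Xs).PosSemidef ∧ (-(scareRes A B Q L R A0 B0 (X k))).PosSemidef := by
    intro k
    induction k with
    | zero => exact ⟨h0ge, h0res⟩
    | succ k ih => exact (step k ih.1 ih.2).2
  have hdec := fun k => (step k (all k).1 (all k).2).1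
  refine ⟨fun k => ⟨hdec k, (all (k+1)).1, (all k).2⟩, ?_⟩
  obtain ⟨Y, hY⟩ := aux_monotone_conv X Xs hsymm hdec fun k => (all k).1
  have hXp : ∀ k, (X k).PosSemidef := fun k => by simpa using (all k).1.add hXs
  have hYp : Y.PosSemidef := aux_psd_closed X Y hXp hY
  have hRY : (Rc R B0 Y).PosDef := aux_Rc hRpd hYp
  have hRcont : Continuous fun Z : Matrix (Fin n) (Fin n) ℝ => Rc R B0 Z := by
    unfold Rc Pi22; fun_prop
  have hinv : Tendsto (fun k => (Rc R B0 (X k))⁻¹) atTop (nhds (Rc R B0 Y)⁻¹) := by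
    have hu : IsUnit (Rc R B0 Y).det := (Matrix.isUnit_iff_isUnit_det _).mp hRY.isUnit
    have h1 : ContinuousAt Ring.inverse (Rc R B0 Y).det := by
      rw [Ring.inverse_eq_inv']
      exact continuousAt_inv₀ hu.ne_zero
    exact (continuousAt_matrix_inv _ h1).tendsto.comp ((hRcont.tendsto Y).comp hY)
  have hpoly : Continuous fun p : Matrix (Fin n) (Fin n) ℝ × Matrix (Fin n) (Fin n) ℝ ×
      Matrix (Fin m) (Fin m) ℝ => Aᵀ * p.2.1 + p.2.1 * A + Qc Q A0 p.1 -
        (p.2.1 * B + Lc L A0 B0 p.1) * p.2.2 * (p.2.1 * B + Lc L A0 B0 p.1)ᵀ := by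
    unfold Qc Lc Pi11 Pi12; fun_prop
  have hlim := (hpoly.tendsto (Y, Y, (Rc R B0 Y)⁻¹)).comp
    (hY.prodMk_nhds ((hY.comp (tendsto_add_atTop_nat 1)).prodMk_nhds hinv))
  have hzero : scareRes A B Q L R A0 B0 Y = 0 := by
    refine tendsto_nhds_unique hlim (tendsto_const_nhds.congr fun k => ?_)
    have := hiter k
    rw [aux_iter_eq hRpd (hXp k) (hsymm (k+1))] at this
    exact this.symm
  rw [← huniq Y hYp hzero]
  exact hY
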